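/- Let π be a probability measure on ℝ^d with finite second moment, absolutely continuous with positive density p ∈ C²(ℝ^d), and set s = ∇ log p. Let k_π ∈ C²(ℝ^d × ℝ^d; ℝ) be symmetric with |k_π| integrable with respect to π⊗π, and assume the Stein identity ∫ k_π(x,y) dπ(x) = 0 for every y ∈ ℝ^d. Assume also (i) there is a continuous function L : ℝ^d → [0,∞), integrable with respect to every probability measure with finite second moment, such that for every y the maps x ↦ ∇₁k_π(x,y) and x ↦ ∇₂k_π(x,y) are L(y)-Lipschitz, and (ii) (x,y) ↦ ‖H₁k_π(x,y)‖_op is ρ⊗ρ′-integrable for all probability measures ρ, ρ′ with finite second moment. Then for every ψ ∈ C_c^∞(ℝ^d), the function G(t) = (1/2)∬ k_π(x + t∇ψ(x), y + t∇ψ(y)) dπ(x)dπ(y) is twice differentiable at t = 0 and G″(0) = ∬ (L_π ψ)(x) · k_π(x,y) · (L_π ψ)(y) dπ(x)dπ(y), where L_π ψ = −Δψ − ⟨∇ log p, ∇ψ⟩. -/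

import Mathlib

open MeasureTheory Function Set
open scoped RealInnerProductSpace NNReal ENNReal

noncomputable section

/-- `ℝ^d` with the Euclidean structure. -/
abbrev Ed (d : ℕ) := EuclideanSpace ℝ (Fin d)

variable {d : ℕ}

/-- Gradient of a kernel in its first variable, `∇₁k(x,y)`. -/
def grad1 (k : Ed d → Ed d → ℝ) (x y : Ed d) : Ed d :=
  gradient (fun x' => k x' y) x

/-- Gradient of a kernel in its second variable, `∇₂k(x,y)`. -/
def grad2 (k : Ed d → Ed d → ℝ) (x y : Ed d) : Ed d :=
  gradient (fun y' => k x y') y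

/-- `div₁∇₂ k (x,y) = Σ_i ∂²k/∂x_i∂y_i (x,y)`. -/
def div1grad2 (k : Ed d → Ed d → ℝ) (x y : Ed d) : ℝ :=
  ∑ i : Fin d,
    fderiv ℝ (fun x' => fderiv ℝ (fun y' => k x' y') y (EuclideanSpace.single i 1)) x
      (EuclideanSpace.single i 1)

/-- The Stein kernel `k_π` built from the base kernel `k` and the score `s = ∇ log π`. -/
def steinKernel (k : Ed d → Ed d → ℝ) (s : Ed d → Ed d) (x y : Ed d) : ℝ :=
  ⟪s x, s y⟫ * k x y + ⟪s x, grad2 k x y⟫ + ⟪grad1 k x y, s y⟫ + div1grad2 k x y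

/-- Hessian of `x ↦ k(x,y)`, as a continuous linear map (`H₁k(x,y)`). -/
def hess1 (k : Ed d → Ed d → ℝ) (x y : Ed d) : Ed d →L[ℝ] Ed d :=
  fderiv ℝ (fun x' => grad1 k x' y) x

/-- Laplacian as the sum of second directional derivatives along the standard basis. -/
def lap (f : Ed d → ℝ) (x : Ed d) : ℝ :=
  ∑ i : Fin d,
    fderiv ℝ (fun x' => fderiv ℝ f x' (EuclideanSpace.single i 1)) x (EuclideanSpace.single i 1)

/-- Differentiation under the integral sign for integrands supported in a fixed compact. -/
theorem aux_param {X : Type*} [TopologicalSpace X] [R1Space X] [MeasurableSpace X]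
    [OpensMeasurableSpace X] (μ : Measure X) [IsFiniteMeasure μ] (K : Set X) (hK : IsCompact K)
    (D D' : ℝ → X → ℝ) (hD : ∀ t, Continuous (D t))
    (hD' : Continuous (uncurry D'))
    (hz : ∀ t, ∀ x ∉ K, D t x = 0) (hz' : ∀ t, ∀ x ∉ K, D' t x = 0)
    (hd : ∀ t x, HasDerivAt (fun s => D s x) (D' t x) t) (t : ℝ) :
    HasDerivAt (fun s => ∫ x, D s x ∂μ) (∫ x, D' t x ∂μ) t := by
  obtain ⟨C, hC⟩ := ((isCompact_closedBall t 1).prod hK).exists_bound_of_continuousOn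
    (f := uncurry D') hD'.continuousOn
  have hc' : ∀ s, Continuous (D' s) := fun s => hD'.comp (by fun_prop : Continuous fun x => (s, x))
  refine (hasDerivAt_integral_of_dominated_loc_of_deriv_le (bound := fun _ => |C|)
    (Metric.closedBall_mem_nhds t one_pos)
    (Filter.Eventually.of_forall fun s => (hD s).aestronglyMeasurable)
    ((hD t).integrable_of_hasCompactSupport (HasCompactSupport.intro hK (hz t)))
    (hc' t).aestronglyMeasurable
    (Filter.Eventually.of_forall fun x s hs => ?_) (integrable_const _)
    (Filter.Eventually.of_forall fun x s _ => hd s x)).2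
  by_cases hx : x ∈ K
  · exact (hC (s, x) ⟨hs, hx⟩).trans (le_abs_self C)
  · rw [hz' s x hx]; simp

theorem aux_apply_sum (A : Ed d →L[ℝ] ℝ) (v : Ed d) :
    A v = ∑ i : Fin d, A (EuclideanSpace.single i 1) * v i := by
  conv_lhs => rw [← (EuclideanSpace.basisFun (Fin d) ℝ).sum_repr v]
  rw [map_sum]
  refine Finset.sum_congr rfl fun i _ => ?_
  rw [map_smul]
  simp [mul_comm]

theorem aux_grad_coord (f : Ed d → ℝ) (x : Ed d) (i : Fin d) :
    gradient f x i = fderiv ℝ f x (EuclideanSpace.single i 1) := by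
  rw [← inner_gradient_left, EuclideanSpace.inner_single_right]
  simp

/-- `L_π ψ`. -/
def Lop (p ψ : Ed d → ℝ) (x : Ed d) : ℝ :=
  -lap ψ x - ⟪gradient (fun w => Real.log (p w)) x, gradient ψ x⟫

theorem aux_ibp (p : Ed d → ℝ) (hp : ContDiff ℝ 2 p) (hppos : ∀ x, 0 < p x)
    (π : Measure (Ed d))
    (hπ : π = (volume : Measure (Ed d)).withDensity (fun x => ENNReal.ofReal (p x)))
    (ψ : Ed d → ℝ) (hψ : ContDiff ℝ 2 ψ) (hs : HasCompactSupport ψ)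
    (f : Ed d → ℝ) (hf : ContDiff ℝ 1 f) :
    ∫ x, fderiv ℝ f x (gradient ψ x) ∂π = ∫ x, f x * Lop p ψ x ∂π := by
  have hm : Measurable fun x => ENNReal.ofReal (p x) := hp.continuous.measurable.ennreal_ofReal
  rw [hπ, integral_withDensity_eq_integral_toReal_smul hm (by simp),
    integral_withDensity_eq_integral_toReal_smul hm (by simp)]
  simp only [ENNReal.toReal_ofReal (hppos _).le, smul_eq_mul]
  have hψ1 : ∀ i : Fin d, ContDiff ℝ 1 fun x => fderiv ℝ ψ x (EuclideanSpace.single i 1) := by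
    intro i
    exact (hψ.fderiv_right (by norm_num)).clm_apply contDiff_const
  have hg : ∀ i : Fin d, ContDiff ℝ 1 fun x => p x * fderiv ℝ ψ x (EuclideanSpace.single i 1) :=
    fun i => (hp.of_le (by norm_num)).mul (hψ1 i)
  have hgs : ∀ i : Fin d,
      HasCompactSupport fun x => p x * fderiv ℝ ψ x (EuclideanSpace.single i 1) :=
    fun i => (hs.fderiv_apply ℝ _).mul_left
  have hf' : Continuous (fderiv ℝ f) := hf.continuous_fderiv (by norm_num)
  have e1 : ∀ x, p x * fderiv ℝ f x (gradient ψ x) = ∑ i : Fin d,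
      fderiv ℝ f x (EuclideanSpace.single i 1) *
        (p x * fderiv ℝ ψ x (EuclideanSpace.single i 1)) := by
    intro x
    rw [aux_apply_sum, Finset.mul_sum]
    refine Finset.sum_congr rfl fun i _ => ?_
    rw [aux_grad_coord]; ring
  have e2 : ∀ x, p x * (f x * Lop p ψ x) = - ∑ i : Fin d,
      f x * fderiv ℝ (fun x => p x * fderiv ℝ ψ x (EuclideanSpace.single i 1)) x
        (EuclideanSpace.single i 1) := by
    intro x
    have hne : p x ≠ 0 := (hppos x).ne'
    have hpd : DifferentiableAt ℝ p x := hp.differentiable (by norm_num) x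
    rw [Lop, lap, inner_gradient_left, aux_apply_sum, ← Finset.sum_neg_distrib,
      ← Finset.sum_neg_distrib, ← Finset.sum_sub_distrib, Finset.mul_sum, Finset.mul_sum]
    refine Finset.sum_congr rfl fun i _ => ?_
    rw [aux_grad_coord, fderiv_fun_mul hpd ((hψ1 i).differentiable (by norm_num) x),
      fderiv.log hpd hne]
    simp only [add_apply, smul_apply, smul_eq_mul]
    field_simp
    ring
  simp_rw [e1, e2]
  have i1 : ∀ i : Fin d, Integrable fun x => fderiv ℝ f x (EuclideanSpace.single i 1) *
        (p x * fderiv ℝ ψ x (EuclideanSpace.single i 1)) := fun i =>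
    ((hf'.clm_apply continuous_const).mul (hg i).continuous).integrable_of_hasCompactSupport
      (hgs i).mul_left
  have i2 : ∀ i : Fin d, Integrable fun x =>
      f x * fderiv ℝ (fun x => p x * fderiv ℝ ψ x (EuclideanSpace.single i 1)) x
        (EuclideanSpace.single i 1) := fun i =>
    (hf.continuous.mul (((hg i).continuous_fderiv (by norm_num)).clm_apply
      continuous_const)).integrable_of_hasCompactSupport ((hgs i).fderiv_apply ℝ _).mul_left
  rw [integral_neg, integral_finsetSum _ fun i _ => i1 i, integral_finsetSum _ fun i _ => i2 i,
    ← Finset.sum_neg_distrib]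
  refine Finset.sum_congr rfl fun i _ => ?_
  rw [integral_mul_fderiv_eq_neg_fderiv_mul_of_integrable (i1 i) (i2 i)
    ((hf.continuous.mul (hg i).continuous).integrable_of_hasCompactSupport (hgs i).mul_left)
    (fun x _ => hf.differentiable (by norm_num) x)
    (fun x _ => (hg i).differentiable (by norm_num) x), neg_neg]

theorem aux_fderiv1 (k : Ed d → Ed d → ℝ) (hk : Differentiable ℝ (uncurry k)) (x y h : Ed d) :
    fderiv ℝ (fun x' => k x' y) x h = fderiv ℝ (uncurry k) (x, y) (h, 0) := by
  have h1 := HasFDerivAt.comp (f := fun x' : Ed d => (x', y)) x (hk (x, y)).hasFDerivAt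
    (hasFDerivAt_prodMk_left (𝕜 := ℝ) x y)
  have h2 : fderiv ℝ (fun x' => k x' y) x = _ := h1.fderiv
  rw [h2]; simp

theorem aux_taylor (k : Ed d → Ed d → ℝ) (hk : ContDiff ℝ 2 (uncurry k))
    (L : Ed d → ℝ) (hLpos : ∀ y, 0 ≤ L y)
    (hLip1 : ∀ y x x', ‖grad1 k x y - grad1 k x' y‖ ≤ L y * ‖x - x'‖) (x z y : Ed d) :
    |k z y - k x y - ⟪grad1 k 0 y, z - x⟫| ≤ L y * (‖x‖ + ‖z‖) * ‖z - x‖ := by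
  have hd : Differentiable ℝ fun x' => k x' y :=
    (hk.differentiable (by norm_num)).comp (f := fun x' : Ed d => (x', y)) (by fun_prop)
  have := Convex.norm_image_sub_le_of_norm_fderiv_le' (𝕜 := ℝ) (f := fun x' => k x' y)
    (s := Metric.closedBall 0 (‖x‖ + ‖z‖)) (C := L y * (‖x‖ + ‖z‖)) (x := x) (y := z)
    (φ := fderiv ℝ (fun x' => k x' y) 0) (fun w _ => hd w) (fun w hw => ?_)
    (convex_closedBall _ _) (by simp) (by simp)
  · rw [Real.norm_eq_abs] at this
    rwa [grad1, inner_gradient_left]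
  · have h1 := hLip1 y w 0
    rw [grad1, grad1, gradient, gradient, ← map_sub, LinearIsometryEquiv.norm_map, sub_zero] at h1
    refine h1.trans (mul_le_mul_of_nonneg_left (by simpa using hw) (hLpos y))

theorem aux_bound (π : Measure (Ed d)) [IsProbabilityMeasure π]
    (hac : (volume : Measure (Ed d)) ≪ π)
    (k : Ed d → Ed d → ℝ) (hk : ContDiff ℝ 2 (uncurry k))
    (hkint : Integrable (fun q : Ed d × Ed d => k q.1 q.2) (π.prod π))
    (L : Ed d → ℝ) (hLpos : ∀ y, 0 ≤ L y) (hLint : Integrable L π)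
    (hLip1 : ∀ y x x', ‖grad1 k x y - grad1 k x' y‖ ≤ L y * ‖x - x'‖) :
    ∃ N : Ed d → ℝ, Integrable N π ∧ ∀ z y, |k z y| ≤ N y * (1 + ‖z‖) ^ 2 := by
  have hT := aux_taylor k hk L hLpos hLip1
  have hkc : ∀ z, Continuous (k z) := fun z =>
    hk.continuous.comp (by fun_prop : Continuous fun y : Ed d => (z, y))
  have hS : ∀ᵐ x ∂(volume : Measure (Ed d)), Integrable (k x) π := hac.ae_le hkint.prod_right_ae
  have hgc : ∀ h, Continuous fun y => ⟪grad1 k 0 y, h⟫ := by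
    intro h
    have : (fun y => ⟪grad1 k 0 y, h⟫) = fun y => fderiv ℝ (uncurry k) (0, y) (h, 0) := by
      funext y
      rw [grad1, inner_gradient_left]
      exact aux_fderiv1 k (hk.differentiable (by norm_num)) 0 y h
    rw [this]
    exact ((hk.continuous_fderiv (by norm_num)).comp (by fun_prop)).clm_apply continuous_const
  have hg : ∀ h, Integrable (fun y => ⟪grad1 k 0 y, h⟫) π := by
    intro h
    have hS' : ∀ᵐ x ∂(volume : Measure (Ed d)), Integrable (k (x + h)) π :=
      (measurePreserving_add_right volume h).quasiMeasurePreserving.ae hS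
    obtain ⟨x, hx, hxh⟩ := (hS.and hS').exists
    refine Integrable.mono' ((hx.abs.add hxh.abs).add
      (hLint.mul_const ((‖x‖ + ‖x + h‖) * ‖h‖))) (hgc h).aestronglyMeasurable
      (Filter.Eventually.of_forall fun y => ?_)
    have := hT x (x + h) y
    simp only [add_sub_cancel_left] at this
    simp only [Pi.add_apply, Real.norm_eq_abs]
    rw [mul_assoc] at this
    rw [abs_le] at this ⊢
    have := abs_le.1 (le_refl |k x y|)
    have := abs_le.1 (le_refl |k (x + h) y|)
    constructor <;> linarith
  have h0 : Integrable (k 0) π := by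
    obtain ⟨x, hx⟩ := hS.exists
    refine Integrable.mono' ((hx.abs.add (hg (0 - x)).abs).add
      (hLint.mul_const ((‖x‖ + ‖(0 : Ed d)‖) * ‖0 - x‖))) (hkc 0).aestronglyMeasurable
      (Filter.Eventually.of_forall fun y => ?_)
    have := hT x 0 y
    simp only [Pi.add_apply, Real.norm_eq_abs]
    rw [mul_assoc] at this
    rw [abs_le] at this ⊢
    have := abs_le.1 (le_refl |k x y|)
    have := abs_le.1 (le_refl |⟪grad1 k 0 y, 0 - x⟫|)
    constructor <;> linarith
  refine ⟨fun y => |k 0 y| + (∑ i : Fin d, |⟪grad1 k 0 y, EuclideanSpace.single i 1⟫|) + L y,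
    (h0.abs.add (integrable_finsetSum _ fun i _ => (hg _).abs)).add hLint, fun z y => ?_⟩
  have h1 : |⟪grad1 k 0 y, z⟫| ≤
      (∑ i : Fin d, |⟪grad1 k 0 y, EuclideanSpace.single i 1⟫|) * ‖z‖ := by
    have := aux_apply_sum (innerSL ℝ (grad1 k 0 y)) z
    simp only [innerSL_apply_apply] at this
    rw [this, Finset.sum_mul]
    refine (Finset.abs_sum_le_sum_abs _ _).trans (Finset.sum_le_sum fun i _ => ?_)
    rw [abs_mul]
    exact mul_le_mul_of_nonneg_left (PiLp.norm_apply_le z i) (abs_nonneg _)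
  have h2 := hT 0 z y
  simp only [sub_zero, norm_zero, zero_add] at h2
  set S := ∑ i : Fin d, |⟪grad1 k 0 y, EuclideanSpace.single i 1⟫| with hSdef
  have hS0 : 0 ≤ S := Finset.sum_nonneg fun i _ => abs_nonneg _
  have hz := norm_nonneg z
  have hl := hLpos y
  have ha := abs_nonneg (k 0 y)
  have h3 : |k z y| ≤ |k 0 y| + |⟪grad1 k 0 y, z⟫| + L y * ‖z‖ * ‖z‖ := by
    rw [abs_le] at h2 ⊢
    have := abs_le.1 (le_refl |k 0 y|)
    have := abs_le.1 (le_refl |⟪grad1 k 0 y, z⟫|)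
    constructor <;> linarith
  have m1 := mul_nonneg ha hz
  have m2 := mul_nonneg hS0 hz
  have m3 := mul_nonneg hl hz
  have m4 := mul_nonneg m1 hz
  have m5 := mul_nonneg m2 hz
  nlinarith

theorem aux_grad_zero (ψ : Ed d → ℝ) (x : Ed d) (hx : x ∉ tsupport ψ) : gradient ψ x = 0 := by
  have : fderiv ℝ ψ x = 0 := by
    by_contra h
    exact hx (support_fderiv_subset ℝ h)
  rw [gradient, this, map_zero]

theorem aux_grad_cont (ψ : Ed d → ℝ) (hψ : ContDiff ℝ 1 ψ) : Continuous (gradient ψ) :=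
  (LinearIsometryEquiv.continuous _).comp (hψ.continuous_fderiv (by norm_num))

theorem aux_Lop_zero (p ψ : Ed d → ℝ) (x : Ed d) (hx : x ∉ tsupport ψ) : Lop p ψ x = 0 := by
  rw [Lop, aux_grad_zero ψ x hx, inner_zero_right, lap, sub_zero, neg_eq_zero]
  refine Finset.sum_eq_zero fun i _ => ?_
  have h : (fun x' => fderiv ℝ ψ x' (EuclideanSpace.single i 1)) =ᶠ[nhds x] fun _ => 0 := by
    filter_upwards [(isClosed_tsupport ψ).isOpen_compl.mem_nhds hx] with z hz
    rw [← inner_gradient_left, aux_grad_zero ψ z hz, inner_zero_left]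
  rw [h.fderiv_eq]; simp

theorem aux_Lop_cont (p ψ : Ed d → ℝ) (hp : ContDiff ℝ 2 p) (hppos : ∀ x, 0 < p x)
    (hψ : ContDiff ℝ 2 ψ) : Continuous (Lop p ψ) := by
  have h1 : Continuous (lap ψ) := by
    refine continuous_finsetSum _ fun i _ => ?_
    have : ContDiff ℝ 1 fun x => fderiv ℝ ψ x (EuclideanSpace.single i 1) :=
      (hψ.fderiv_right (by norm_num)).clm_apply contDiff_const
    exact (this.continuous_fderiv (by norm_num)).clm_apply continuous_const
  have h2 : ContDiff ℝ 1 fun w => Real.log (p w) :=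
    (hp.of_le (by norm_num)).log fun x => (hppos x).ne'
  exact h1.neg.sub ((aux_grad_cont _ h2).inner (aux_grad_cont _ (hψ.of_le (by norm_num))))

theorem aux_ibp2 (p : Ed d → ℝ) (hp : ContDiff ℝ 2 p) (hppos : ∀ x, 0 < p x)
    (π : Measure (Ed d)) [IsProbabilityMeasure π]
    (hπ : π = (volume : Measure (Ed d)).withDensity (fun x => ENNReal.ofReal (p x)))
    (ψ : Ed d → ℝ) (hψ : ContDiff ℝ 2 ψ) (hs : HasCompactSupport ψ)
    (k : Ed d → Ed d → ℝ) (hk : ContDiff ℝ 2 (uncurry k)) :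
    ∫ x, ∫ y, fderiv ℝ (fderiv ℝ (uncurry k)) (x, y) (0, gradient ψ y) (gradient ψ x, 0) ∂π ∂π =
      ∫ x, ∫ y, Lop p ψ x * k x y * Lop p ψ y ∂π ∂π := by
  have hv := aux_grad_cont ψ (hψ.of_le (by norm_num))
  have hl := aux_Lop_cont p ψ hp hppos hψ
  have hk1 : ContDiff ℝ 1 (fderiv ℝ (uncurry k)) := hk.fderiv_right (by norm_num)
  have s1 : ∀ x, ∫ y, fderiv ℝ (fderiv ℝ (uncurry k)) (x, y) (0, gradient ψ y)
      (gradient ψ x, 0) ∂π =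
      ∫ y, fderiv ℝ (uncurry k) (x, y) (gradient ψ x, 0) * Lop p ψ y ∂π := by
    intro x
    rw [← aux_ibp p hp hppos π hπ ψ hψ hs
      (fun y => fderiv ℝ (uncurry k) (x, y) (gradient ψ x, 0))
      ((hk1.comp (by fun_prop : ContDiff ℝ 1 fun y : Ed d => (x, y))).clm_apply contDiff_const)]
    refine integral_congr_ae (Filter.Eventually.of_forall fun y => ?_)
    have h1 := HasFDerivAt.comp (f := fun y' : Ed d => (x, y')) y
      (hk1.differentiable (by norm_num) (x, y)).hasFDerivAt
      (hasFDerivAt_prodMk_right (𝕜 := ℝ) x y)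
    have h2 := h1.clm_apply (hasFDerivAt_const ((gradient ψ x, 0) : Ed d × Ed d) y)
    have h3 : fderiv ℝ (fun y => fderiv ℝ (uncurry k) (x, y) (gradient ψ x, 0)) y = _ := h2.fderiv
    simp only [h3]
    simp
  have s2 : ∀ y, ∫ x, fderiv ℝ (uncurry k) (x, y) (gradient ψ x, 0) * Lop p ψ y ∂π =
      ∫ x, Lop p ψ x * k x y * Lop p ψ y ∂π := by
    intro y
    rw [integral_mul_const, integral_mul_const]
    congr 1
    simp_rw [mul_comm (Lop p ψ _)]
    rw [← aux_ibp p hp hppos π hπ ψ hψ hs (fun x => k x y)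
      ((hk.comp (by fun_prop : ContDiff ℝ 2 fun x : Ed d => (x, y))).of_le (by norm_num))]
    refine integral_congr_ae (Filter.Eventually.of_forall fun x => ?_)
    exact (aux_fderiv1 k (hk.differentiable (by norm_num)) x y _).symm
  simp_rw [s1]
  have hK : IsCompact (tsupport ψ ×ˢ tsupport ψ) := IsCompact.prod hs hs
  have h00 : ((0, 0) : Ed d × Ed d) = 0 := rfl
  have sw1 := integral_integral_swap_of_hasCompactSupport (μ := π) (ν := π)
    (f := fun x y => fderiv ℝ (uncurry k) (x, y) (gradient ψ x, 0) * Lop p ψ y)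
    ((hk1.continuous.clm_apply ((hv.comp continuous_fst).prodMk continuous_const)).mul
      (hl.comp continuous_snd))
    (by
      refine HasCompactSupport.intro hK fun z hz => ?_
      rw [Set.mem_prod, not_and_or] at hz
      rcases hz with h | h
      · simp [uncurry, aux_grad_zero ψ _ h, h00]
      · simp [uncurry, aux_Lop_zero p ψ _ h])
  have sw2 := integral_integral_swap_of_hasCompactSupport (μ := π) (ν := π)
    (f := fun x y => Lop p ψ x * k x y * Lop p ψ y)
    (((hl.comp continuous_fst).mul hk.continuous).mul (hl.comp continuous_snd))
    (by
      refine HasCompactSupport.intro hK fun z hz => ?_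
      rw [Set.mem_prod, not_and_or] at hz
      rcases hz with h | h
      · simp [uncurry, aux_Lop_zero p ψ _ h]
      · simp [uncurry, aux_Lop_zero p ψ _ h])
  rw [sw1, sw2]
  simp_rw [s2]

/-- The doubly centred kernel along the flow. -/
def Dker (k : Ed d → Ed d → ℝ) (v : Ed d → Ed d) (t : ℝ) (z : Ed d × Ed d) : ℝ :=
  uncurry k (z + t • (v z.1, v z.2)) - uncurry k (z + t • (v z.1, 0)) -
    uncurry k (z + t • (0, v z.2)) + uncurry k z

/-- First derivative of `Dker`. -/
def Dker1 (k : Ed d → Ed d → ℝ) (v : Ed d → Ed d) (t : ℝ) (z : Ed d × Ed d) : ℝ :=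
  fderiv ℝ (uncurry k) (z + t • (v z.1, v z.2)) (v z.1, v z.2) -
    fderiv ℝ (uncurry k) (z + t • (v z.1, 0)) (v z.1, 0) -
    fderiv ℝ (uncurry k) (z + t • (0, v z.2)) (0, v z.2)

/-- Second derivative of `Dker`. -/
def Dker2 (k : Ed d → Ed d → ℝ) (v : Ed d → Ed d) (t : ℝ) (z : Ed d × Ed d) : ℝ :=
  fderiv ℝ (fderiv ℝ (uncurry k)) (z + t • (v z.1, v z.2)) (v z.1, v z.2) (v z.1, v z.2) -
    fderiv ℝ (fderiv ℝ (uncurry k)) (z + t • (v z.1, 0)) (v z.1, 0) (v z.1, 0) -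
    fderiv ℝ (fderiv ℝ (uncurry k)) (z + t • (0, v z.2)) (0, v z.2) (0, v z.2)

theorem aux_D_zero (k : Ed d → Ed d → ℝ) (v : Ed d → Ed d) (K : Set (Ed d))
    (hv : ∀ x ∉ K, v x = 0) (t : ℝ) (z : Ed d × Ed d) (hz : z ∉ K ×ˢ K) :
    Dker k v t z = 0 ∧ Dker1 k v t z = 0 ∧ Dker2 k v t z = 0 := by
  rw [Set.mem_prod, not_and_or] at hz
  have h0 : ((0, 0) : Ed d × Ed d) = 0 := rfl
  rcases hz with h | h
  · simp [Dker, Dker1, Dker2, hv _ h, h0]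
  · simp [Dker, Dker1, Dker2, hv _ h, h0]

theorem aux_D_deriv (k : Ed d → Ed d → ℝ) (hk : ContDiff ℝ 2 (uncurry k))
    (v : Ed d → Ed d) (t : ℝ) (z : Ed d × Ed d) :
    HasDerivAt (fun s => Dker k v s z) (Dker1 k v t z) t ∧
    HasDerivAt (fun s => Dker1 k v s z) (Dker2 k v t z) t := by
  have hk1 : ContDiff ℝ 1 (fderiv ℝ (uncurry k)) := hk.fderiv_right (by norm_num)
  have hl : ∀ w : Ed d × Ed d, HasDerivAt (fun s : ℝ => z + s • w) w t := by
    intro w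
    simpa using ((hasDerivAt_id t).smul_const w).const_add z
  have h1 : ∀ w : Ed d × Ed d, HasDerivAt (fun s : ℝ => uncurry k (z + s • w))
      (fderiv ℝ (uncurry k) (z + t • w) w) t := fun w =>
    (hk.differentiable (by norm_num) _).hasFDerivAt.comp_hasDerivAt t (hl w)
  have h2 : ∀ w : Ed d × Ed d, HasDerivAt (fun s : ℝ => fderiv ℝ (uncurry k) (z + s • w) w)
      (fderiv ℝ (fderiv ℝ (uncurry k)) (z + t • w) w w) t := by
    intro w
    have h3 : HasDerivAt (fun s : ℝ => fderiv ℝ (uncurry k) (z + s • w)) _ t :=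
      (hk1.differentiable (by norm_num) _).hasFDerivAt.comp_hasDerivAt t (hl w)
    simpa using h3.clm_apply (hasDerivAt_const t w)
  exact ⟨(((h1 _).sub (h1 _)).sub (h1 _)).add_const _, ((h2 _).sub (h2 _)).sub (h2 _)⟩

theorem aux_D_cont (k : Ed d → Ed d → ℝ) (hk : ContDiff ℝ 2 (uncurry k))
    (v : Ed d → Ed d) (hv : Continuous v) :
    Continuous (uncurry (Dker k v)) ∧ Continuous (uncurry (Dker1 k v)) ∧
      Continuous (uncurry (Dker2 k v)) := by
  have hk0 := hk.continuous
  have hk1 : ContDiff ℝ 1 (fderiv ℝ (uncurry k)) := hk.fderiv_right (by norm_num)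
  have hc1 := hk1.continuous
  have hc2 := hk1.continuous_fderiv (by norm_num)
  have hw : ∀ w : Ed d × Ed d → Ed d × Ed d, Continuous w →
      Continuous (fun q : ℝ × (Ed d × Ed d) => q.2 + q.1 • w q.2) := by
    intro w hw; fun_prop
  have w1 : Continuous fun z : Ed d × Ed d => (v z.1, v z.2) := by fun_prop
  have w2 : Continuous fun z : Ed d × Ed d => ((v z.1, 0) : Ed d × Ed d) := by fun_prop
  have w3 : Continuous fun z : Ed d × Ed d => ((0, v z.2) : Ed d × Ed d) := by fun_prop
  refine ⟨?_, ?_, ?_⟩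
  · exact (((hk0.comp (hw _ w1)).sub (hk0.comp (hw _ w2))).sub (hk0.comp (hw _ w3))).add
      (hk0.comp continuous_snd)
  · have g : ∀ w : Ed d × Ed d → Ed d × Ed d, Continuous w → Continuous
        (fun q : ℝ × (Ed d × Ed d) => fderiv ℝ (uncurry k) (q.2 + q.1 • w q.2) (w q.2)) :=
      fun w h => (hc1.comp (hw w h)).clm_apply (h.comp continuous_snd)
    have a1 := g (fun z => (v z.1, v z.2)) w1
    have a2 := g (fun z => (v z.1, 0)) w2
    have a3 := g (fun z => (0, v z.2)) w3
    exact (a1.sub a2).sub a3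
  · have g : ∀ w : Ed d × Ed d → Ed d × Ed d, Continuous w → Continuous
        (fun q : ℝ × (Ed d × Ed d) =>
          fderiv ℝ (fderiv ℝ (uncurry k)) (q.2 + q.1 • w q.2) (w q.2) (w q.2)) :=
      fun w h => ((hc2.comp (hw w h)).clm_apply (h.comp continuous_snd)).clm_apply
        (h.comp continuous_snd)
    have a1 := g (fun z => (v z.1, v z.2)) w1
    have a2 := g (fun z => (v z.1, 0)) w2
    have a3 := g (fun z => (0, v z.2)) w3
    exact (a1.sub a2).sub a3

theorem aux_D2_zero (k : Ed d → Ed d → ℝ) (hk : ContDiff ℝ 2 (uncurry k))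
    (v : Ed d → Ed d) (z : Ed d × Ed d) :
    Dker2 k v 0 z = 2 * fderiv ℝ (fderiv ℝ (uncurry k)) z (0, v z.2) (v z.1, 0) := by
  have hsym : IsSymmSndFDerivAt ℝ (uncurry k) z :=
    hk.contDiffAt.isSymmSndFDerivAt (by simp)
  have e : ((v z.1, v z.2) : Ed d × Ed d) = (v z.1, 0) + (0, v z.2) := by simp
  simp only [Dker2, zero_smul, add_zero]
  rw [e]
  simp only [map_add, add_apply]
  rw [hsym (v z.1, 0) (0, v z.2)]
  ring

theorem aux_G (π : Measure (Ed d)) [IsProbabilityMeasure π]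
    (hπ2 : Integrable (fun x => ‖x‖ ^ 2) π)
    (k : Ed d → Ed d → ℝ) (hk : ContDiff ℝ 2 (uncurry k))
    (hsymm : ∀ x y, k x y = k y x) (hstein : ∀ y, ∫ x, k x y ∂π = 0)
    (N : Ed d → ℝ) (hN : Integrable N π) (hb : ∀ z y, |k z y| ≤ N y * (1 + ‖z‖) ^ 2)
    (v : Ed d → Ed d) (hv : Continuous v) (K : Set (Ed d)) (hK : IsCompact K)
    (hv0 : ∀ x ∉ K, v x = 0) (t : ℝ) :
    ∫ x, (∫ y, k (x + t • v x) (y + t • v y) ∂π) ∂π = ∫ z, Dker k v t z ∂(π.prod π) := by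
  have hkc := hk.continuous
  have hDi : Integrable (Dker k v t) (π.prod π) :=
    ((aux_D_cont k hk v hv).1.comp (by fun_prop : Continuous fun z : Ed d × Ed d =>
      (t, z))).integrable_of_hasCompactSupport
      (HasCompactSupport.intro (hK.prod hK) fun z hz => (aux_D_zero k v K hv0 t z hz).1)
  have hstein' : ∀ x, ∫ y, k x y ∂π = 0 := fun x => by
    simp_rw [hsymm x]; exact hstein x
  have hb' : ∀ z y, |k z y| ≤ N z * (1 + ‖y‖) ^ 2 := fun z y => by rw [hsymm]; exact hb y z
  obtain ⟨M, hM⟩ := hK.exists_bound_of_continuousOn hv.continuousOn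
  have hM' : ∀ y, ‖y + t • v y‖ ≤ ‖y‖ + |t| * |M| := by
    intro y
    refine (norm_add_le _ _).trans (add_le_add_right ?_ _)
    rw [norm_smul, Real.norm_eq_abs]
    refine mul_le_mul_of_nonneg_left ?_ (abs_nonneg _)
    by_cases h : y ∈ K
    · exact (hM y h).trans (le_abs_self M)
    · rw [hv0 y h]; simp
  have hW : Integrable (fun y => (1 + ‖y + t • v y‖) ^ 2) π := by
    refine Integrable.mono' ((integrable_const (2 * (1 + |t| * |M|) ^ 2)).add (hπ2.const_mul 2))
      (by fun_prop) (Filter.Eventually.of_forall fun y => ?_)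
    simp only [Pi.add_apply, Real.norm_eq_abs, abs_pow, sq_abs]
    have h1 : (1 + ‖y + t • v y‖) ^ 2 ≤ ((1 + |t| * |M|) + ‖y‖) ^ 2 := by
      refine pow_le_pow_left₀ (by positivity) ?_ 2
      have := hM' y
      linarith
    nlinarith [sq_nonneg ((1 + |t| * |M|) - ‖y‖)]
  have hmT : Continuous fun y : Ed d => y + t • v y := by fun_prop
  have i1 : ∀ z, Integrable (fun y => k z (y + t • v y)) π := fun z =>
    Integrable.mono' (hW.const_mul (N z))
      (hkc.comp (continuous_const.prodMk hmT)).aestronglyMeasurable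
      (Filter.Eventually.of_forall fun y => hb' z _)
  have i2 : ∀ z, Integrable (fun y => k z y) π := fun z =>
    Integrable.mono' (hN.mul_const ((1 + ‖z‖) ^ 2))
      (hkc.comp (continuous_const.prodMk continuous_id)).aestronglyMeasurable
      (Filter.Eventually.of_forall fun y => hb z _)
  have i3 : Integrable (fun q : Ed d × Ed d => k q.1 (q.2 + t • v q.2)) (π.prod π) :=
    Integrable.mono' (hN.mul_prod hW)
      (hkc.comp (continuous_fst.prodMk (hmT.comp continuous_snd))).aestronglyMeasurable
      (Filter.Eventually.of_forall fun q => hb' _ _)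
  have hB : ∫ x, (∫ y, k x (y + t • v y) ∂π) ∂π = 0 := by
    rw [integral_integral_swap i3]
    simp [hstein]
  have hinner : ∀ x, ∫ y, k (x + t • v x) (y + t • v y) ∂π =
      (∫ y, Dker k v t (x, y) ∂π) + ∫ y, k x (y + t • v y) ∂π := by
    intro x
    have : ∀ y, Dker k v t (x, y) = k (x + t • v x) (y + t • v y) - k (x + t • v x) y -
        k x (y + t • v y) + k x y := by
      intro y; simp [Dker, uncurry]
    simp_rw [this]
    have j1 := (i1 (x + t • v x)).sub (i2 (x + t • v x))
    have j2 := j1.sub (i1 x)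
    have e1 := integral_add j2 (i2 x)
    have e2 := integral_sub j1 (i1 x)
    have e3 := integral_sub (i1 (x + t • v x)) (i2 (x + t • v x))
    simp only [Pi.sub_apply] at e1 e2 e3
    rw [e1, e2, e3, hstein', hstein']
    ring
  simp_rw [hinner]
  rw [integral_add hDi.integral_prod_left i3.integral_prod_left, hB, add_zero, integral_prod _ hDi]

/-- At the target `π` (with positive `C²` density `p` and score
`s = ∇ log p`), thanks to the Stein identity `∫ k_π(x,·)dπ(x) = 0`, the second derivative at
`t = 0` of the squared KSD functional along `ρ_t = (I + t∇ψ)_#π` equals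
`∬ (L_πψ)(x) k_π(x,y) (L_πψ)(y) dπ(x)dπ(y)` where `L_πψ = −Δψ − ⟨∇log p, ∇ψ⟩`. -/
theorem statement8 {d : ℕ}
    (p : Ed d → ℝ) (hp : ContDiff ℝ 2 p) (hppos : ∀ x, 0 < p x)
    (π : Measure (Ed d)) [IsProbabilityMeasure π]
    (hπ : π = (volume : Measure (Ed d)).withDensity (fun x => ENNReal.ofReal (p x)))
    (hπ2 : Integrable (fun x => ‖x‖ ^ 2) π)
    (kπ : Ed d → Ed d → ℝ)
    (hkC2 : ContDiff ℝ 2 (uncurry kπ))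
    (hsymm : ∀ x y, kπ x y = kπ y x)
    (hkint : Integrable (fun q : Ed d × Ed d => kπ q.1 q.2) (π.prod π))
    (hstein : ∀ y, ∫ x, kπ x y ∂π = 0)
    (L : Ed d → ℝ) (hLpos : ∀ y, 0 ≤ L y) (hLcont : Continuous L)
    (hLint : ∀ ρ : Measure (Ed d), IsProbabilityMeasure ρ →
      Integrable (fun x => ‖x‖ ^ 2) ρ → Integrable L ρ)
    (hLip1 : ∀ y x x', ‖grad1 kπ x y - grad1 kπ x' y‖ ≤ L y * ‖x - x'‖)
    (hLip2 : ∀ y x x', ‖grad2 kπ x y - grad2 kπ x' y‖ ≤ L y * ‖x - x'‖)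
    (hHess : ∀ ρ ρ' : Measure (Ed d), IsProbabilityMeasure ρ → IsProbabilityMeasure ρ' →
      Integrable (fun x => ‖x‖ ^ 2) ρ → Integrable (fun x => ‖x‖ ^ 2) ρ' →
      Integrable (fun q : Ed d × Ed d => ‖hess1 kπ q.1 q.2‖) (ρ.prod ρ')) :
    ∀ ψ : Ed d → ℝ, ContDiff ℝ (⊤ : ℕ∞) ψ → HasCompactSupport ψ →
    ∀ G : ℝ → ℝ,
      (∀ t, G t = (1/2) *
        ∫ x, (∫ y, kπ (x + t • gradient ψ x) (y + t • gradient ψ y) ∂π) ∂π) →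
      (∀ t : ℝ, DifferentiableAt ℝ G t) ∧
      HasDerivAt (deriv G)
        (∫ x, (∫ y,
          (-lap ψ x - ⟪gradient (fun w => Real.log (p w)) x, gradient ψ x⟫) * kπ x y *
            (-lap ψ y - ⟪gradient (fun w => Real.log (p w)) y, gradient ψ y⟫) ∂π) ∂π)
        0 := by
  intro ψ hψ hs G hG
  have hψ2 : ContDiff ℝ 2 ψ := hψ.of_le (by norm_cast)
  have hv := aux_grad_cont ψ (hψ2.of_le (by norm_num))
  have hac : (volume : Measure (Ed d)) ≪ π := by
    rw [hπ]
    exact withDensity_absolutelyContinuous'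
      hp.continuous.measurable.ennreal_ofReal.aemeasurable
      (Filter.Eventually.of_forall fun x => by simpa using hppos x)
  obtain ⟨N, hN, hb⟩ := aux_bound π hac kπ hkC2 hkint L hLpos
    (hLint π inferInstance hπ2) hLip1
  have hz := aux_D_zero kπ (gradient ψ) (tsupport ψ) (aux_grad_zero ψ)
  have hc := aux_D_cont kπ hkC2 (gradient ψ) hv
  have hK : IsCompact (tsupport ψ ×ˢ tsupport ψ) := IsCompact.prod hs hs
  have hsl : ∀ t : ℝ, Continuous fun z : Ed d × Ed d => (t, z) := fun t => by fun_prop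
  have hGe : G = fun t => (1 / 2) * ∫ z, Dker kπ (gradient ψ) t z ∂(π.prod π) := by
    funext t
    rw [hG t, aux_G π hπ2 kπ hkC2 hsymm hstein N hN hb (gradient ψ) hv (tsupport ψ) hs
      (aux_grad_zero ψ) t]
  have hG1 : ∀ t, HasDerivAt G ((1 / 2) * ∫ z, Dker1 kπ (gradient ψ) t z ∂(π.prod π)) t := by
    intro t
    rw [hGe]
    exact (aux_param (π.prod π) _ hK (Dker kπ (gradient ψ)) (Dker1 kπ (gradient ψ))
      (fun s => hc.1.comp (hsl s)) hc.2.1 (fun s z h => (hz s z h).1)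
      (fun s z h => (hz s z h).2.1) (fun s z => (aux_D_deriv kπ hkC2 _ s z).1) t).const_mul _
  refine ⟨fun t => (hG1 t).differentiableAt, ?_⟩
  have hG' : deriv G = fun t => (1 / 2) * ∫ z, Dker1 kπ (gradient ψ) t z ∂(π.prod π) :=
    funext fun t => (hG1 t).deriv
  rw [hG']
  have h2 := (aux_param (π.prod π) _ hK (Dker1 kπ (gradient ψ)) (Dker2 kπ (gradient ψ))
      (fun s => hc.2.1.comp (hsl s)) hc.2.2 (fun s z h => (hz s z h).2.1)
      (fun s z h => (hz s z h).2.2) (fun s z => (aux_D_deriv kπ hkC2 _ s z).2) 0).const_mul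
      (1 / 2 : ℝ)
  have hi : Integrable (Dker2 kπ (gradient ψ) 0) (π.prod π) :=
    (hc.2.2.comp (hsl 0)).integrable_of_hasCompactSupport
      (HasCompactSupport.intro hK fun z h => (hz 0 z h).2.2)
  have key : (1 / 2 : ℝ) * ∫ z, Dker2 kπ (gradient ψ) 0 z ∂(π.prod π) =
      ∫ x, ∫ y, Lop p ψ x * kπ x y * Lop p ψ y ∂π ∂π := by
    rw [integral_prod _ hi]
    simp_rw [aux_D2_zero kπ hkC2]
    simp_rw [integral_const_mul]
    rw [aux_ibp2 p hp hppos π hπ ψ hψ2 hs kπ hkC2]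
    ring
  rw [key] at h2
  exact h2
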